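/- arXiv:1902.01208 — 3 statements merged into one kernel-verified Lean document; each statement's English description precedes it below -/
import Mathlib

section
/- Let n ≥ 1, let u, w : Fin n → ℝ with u i ≥ 0 for all i, and let l, x, h : Fin n → ℝ satisfy l i ≤ x i ≤ h i for all i. Set a = max_i u i * (l i - w i), b = max_i u i * (h i - w i), and t = max_i u i * (x i - w i) (maxima over the finite nonempty index set). Then a ≤ t ≤ b, and consequently exp(-(max (a^2) (b^2))) ≤ exp(-t^2) ≤ 1; moreover if b ≤ 0 then exp(-t^2) ≤ exp(-b^2), and if 0 ≤ a then exp(-t^2) ≤ exp(-a^2). -/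
open Real

theorem mwd_interval_sound (n : ℕ) (hn : 1 ≤ n) (u w l x h : Fin n → ℝ)
    (hu : ∀ i, 0 ≤ u i) (hlx : ∀ i, l i ≤ x i) (hxh : ∀ i, x i ≤ h i)
    (a b t : ℝ)
    (ha : a = Finset.univ.sup' ⟨⟨0, hn⟩, Finset.mem_univ _⟩ fun i => u i * (l i - w i))
    (hb : b = Finset.univ.sup' ⟨⟨0, hn⟩, Finset.mem_univ _⟩ fun i => u i * (h i - w i))
    (ht : t = Finset.univ.sup' ⟨⟨0, hn⟩, Finset.mem_univ _⟩ fun i => u i * (x i - w i)) :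
    a ≤ t ∧ t ≤ b ∧
    Real.exp (-(max (a ^ 2) (b ^ 2))) ≤ Real.exp (-(t ^ 2)) ∧
    Real.exp (-(t ^ 2)) ≤ 1 ∧
    (b ≤ 0 → Real.exp (-(t ^ 2)) ≤ Real.exp (-(b ^ 2))) ∧
    (0 ≤ a → Real.exp (-(t ^ 2)) ≤ Real.exp (-(a ^ 2))) := by
  have hat : a ≤ t := by
    rw [ha, ht]
    refine Finset.sup'_mono_fun fun i _ => ?_
    exact mul_le_mul_of_nonneg_left (by linarith [hlx i]) (hu i)
  have htb : t ≤ b := by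
    rw [ht, hb]
    refine Finset.sup'_mono_fun fun i _ => ?_
    exact mul_le_mul_of_nonneg_left (by linarith [hxh i]) (hu i)
  clear ha hb ht
  refine ⟨hat, htb, ?_, ?_, ?_, ?_⟩
  · rw [Real.exp_le_exp, neg_le_neg_iff, le_max_iff]
    rcases le_total 0 t with h0 | h0
    · right
      nlinarith
    · left
      nlinarith
  · rw [Real.exp_le_one_iff]
    nlinarith [sq_nonneg t]
  · intro h0
    rw [Real.exp_le_exp]
    nlinarith
  · intro h0
    rw [Real.exp_le_exp]
    nlinarith
end

section
/- Let 0 < ε < 1/2, let N ≥ 1 and M ≥ 1, let c : Fin M → Fin 3 → Fin N × Bool encode the clauses of a 3-SAT instance, and let e = exp 1 and w₀ = exp(-(2 - 1/e)^2). Define the literal function L : Fin N × Bool → (Fin N → ℝ) → ℝ by L (i, b) x = exp(-|x i - (1/2 + (if b then ε else -ε))| / ε), and the network output F : (Fin N → ℝ) → ℝ by F x = exp(-(max_{j ∈ Fin M} (exp(-(max_{k ∈ Fin 3} 2 * (L (c j k) x - 1/(2e)))^2) - w₀))^2). Suppose σ : Fin N → Bool satisfies every clause, i.e., for every j there exists k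 with σ (c j k).1 = (c j k).2. Then for the input x defined by x i = 1/2 + (if σ i then ε else -ε), which is an ε-perturbation of the all-1/2 input, F x = 1. -/
open Real

theorem reduction_completeness (ε : ℝ) (hε0 : 0 < ε) (hε : ε < 1 / 2)
    (N M : ℕ) (hN : 1 ≤ N) (hM : 1 ≤ M)
    (c : Fin M → Fin 3 → Fin N × Bool)
    (w₀ : ℝ) (hw₀ : w₀ = Real.exp (-((2 - 1 / Real.exp 1) ^ 2)))
    (L : Fin N × Bool → (Fin N → ℝ) → ℝ)
    (hL : ∀ (i : Fin N) (b : Bool) (x : Fin N → ℝ),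
      L (i, b) x = Real.exp (-|x i - (1 / 2 + (if b then ε else -ε))| / ε))
    (F : (Fin N → ℝ) → ℝ)
    (hF : ∀ x : Fin N → ℝ, F x = Real.exp (-((Finset.univ.sup'
        ⟨⟨0, hM⟩, Finset.mem_univ _⟩ fun j =>
          Real.exp (-((Finset.univ.sup' Finset.univ_nonempty fun k =>
            2 * (L (c j k) x - 1 / (2 * Real.exp 1))) ^ 2)) - w₀) ^ 2)))
    (σ : Fin N → Bool)
    (hσ : ∀ j, ∃ k, σ (c j k).1 = (c j k).2) :
    F (fun i => 1 / 2 + (if σ i then ε else -ε)) = 1 := by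
  rw [hF]
  have key : ∀ j : Fin M, (Finset.univ.sup' Finset.univ_nonempty fun k =>
      2 * (L (c j k) (fun i => 1 / 2 + (if σ i then ε else -ε)) - 1 / (2 * Real.exp 1)))
      = 2 - 1 / Real.exp 1 := by
    intro j
    have he : 2 * ((1 : ℝ) - 1 / (2 * Real.exp 1)) = 2 - 1 / Real.exp 1 := by
      have := Real.exp_pos 1
      field_simp
    apply le_antisymm
    · apply Finset.sup'_le
      intro k _
      rw [← he]
      have h1 : L (c j k) (fun i => 1 / 2 + (if σ i then ε else -ε)) ≤ 1 := by
        rw [show c j k = ((c j k).1, (c j k).2) from rfl, hL, Real.exp_le_one_iff]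
        apply div_nonpos_of_nonpos_of_nonneg _ hε0.le
        exact neg_nonpos.mpr (abs_nonneg _)
      linarith
    · obtain ⟨k, hk⟩ := hσ j
      have h1 : L (c j k) (fun i => 1 / 2 + (if σ i then ε else -ε)) = 1 := by
        rw [show c j k = ((c j k).1, (c j k).2) from rfl, hL]
        simp [hk]
      refine le_trans (le_of_eq ?_) (Finset.le_sup' _ (Finset.mem_univ k))
      simp only [h1, he]
  simp only [key, ← hw₀, sub_self]
  simp
  exact Finset.sup'_const _ _
end

section
/- Let 0 < ε < 1/2, let N ≥ 1 and M ≥ 1, let c : Fin M → Fin 3 → Fin N × Bool encode the clauses of a 3-SAT instance, and let e = exp 1 and w₀ = exp(-(2 - 1/e)^2). Define the literal function L : Fin N × Bool → (Fin N → ℝ) → ℝ by L (i, b) x = exp(-|x i - (1/2 + (if b then ε else -ε))| / ε), and the network output F : (Fin N → ℝ) → ℝ by F x = exp(-(max_{j ∈ Fin M} (exp(-(max_{k ∈ Fin 3} 2 * (L (c j k) x - 1/(2e)))^2) - w₀))^2). If x satisfies 1/2 - ε ≤ x i ≤ 1/2 + ε for all i and F x > 0.6, then the assignment σ : Fin N →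 Bool defined by σ i = (x i > 1/2) satisfies every clause: for every j there exists k with σ (c j k).1 = (c j k).2. -/
open Real

theorem reduction_soundness (ε : ℝ) (hε0 : 0 < ε) (hε : ε < 1 / 2)
    (N M : ℕ) (hN : 1 ≤ N) (hM : 1 ≤ M)
    (c : Fin M → Fin 3 → Fin N × Bool)
    (w₀ : ℝ) (hw₀ : w₀ = Real.exp (-((2 - 1 / Real.exp 1) ^ 2)))
    (L : Fin N × Bool → (Fin N → ℝ) → ℝ)
    (hL : ∀ (i : Fin N) (b : Bool) (x : Fin N → ℝ),
      L (i, b) x = Real.exp (-|x i - (1 / 2 + (if b then ε else -ε))| / ε))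
    (F : (Fin N → ℝ) → ℝ)
    (hF : ∀ x : Fin N → ℝ, F x = Real.exp (-((Finset.univ.sup'
        ⟨⟨0, hM⟩, Finset.mem_univ _⟩ fun j =>
          Real.exp (-((Finset.univ.sup' Finset.univ_nonempty fun k =>
            2 * (L (c j k) x - 1 / (2 * Real.exp 1))) ^ 2)) - w₀) ^ 2)))
    (x : Fin N → ℝ) (hx : ∀ i, 1 / 2 - ε ≤ x i ∧ x i ≤ 1 / 2 + ε)
    (hFx : F x > 0.6) :
    ∀ j, ∃ k, (decide ((1 : ℝ) / 2 < x (c j k).1)) = (c j k).2 := by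
  intro j
  by_contra hne
  push Not at hne
  have he1 : 2.7182818283 < Real.exp 1 := Real.exp_one_gt_d9
  have hepos : 0 < Real.exp 1 := Real.exp_pos 1
  obtain ⟨q, hq⟩ : ∃ q, q = 1 / Real.exp 1 := ⟨_, rfl⟩
  have hq0 : 0 < q := by rw [hq]; positivity
  have hq1 : q < 0.3679 := by
    rw [hq, div_lt_iff₀ hepos]; linarith
  have hqe : Real.exp (-1) = q := by rw [hq, Real.exp_neg, one_div]
  have hq2 : 1 / (2 * Real.exp 1) = q / 2 := by rw [hq]; field_simp
  have hLb : ∀ k, 0 < L (c j k) x ∧ L (c j k) x ≤ q := by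
    intro k
    have h := hne k
    obtain ⟨i, b, hc⟩ : ∃ i b, c j k = (i, b) := ⟨_, _, rfl⟩
    rw [hc] at h ⊢
    rw [hL]
    refine ⟨Real.exp_pos _, ?_⟩
    rw [← hqe]
    apply Real.exp_le_exp.mpr
    rw [div_le_iff₀ hε0]
    cases b
    · simp at h
      have := le_abs_self (x i - (1 / 2 + -ε))
      norm_num at this ⊢
      linarith
    · simp at h
      have := neg_le_abs (x i - (1 / 2 + ε))
      norm_num at this ⊢
      linarith
  rw [hF] at hFx
  simp only [hq2] at hFx
  have hw : w₀ ≤ 0.1354 := by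
    have h1 : w₀ ≤ Real.exp (-1 + -1) := by
      rw [hw₀, ← hq]
      apply Real.exp_le_exp.mpr
      nlinarith
    rw [Real.exp_add, hqe] at h1
    nlinarith
  have hm : ∀ m : ℝ, -q ≤ m → m ≤ q → 0.8646 ≤ Real.exp (-(m ^ 2)) := by
    intro m h1 h2
    have := Real.add_one_le_exp (-(m ^ 2))
    nlinarith
  have hd : 0.7292 ≤ Finset.univ.sup' (⟨⟨0, hM⟩, Finset.mem_univ _⟩ : (Finset.univ : Finset (Fin M)).Nonempty) fun j =>
          Real.exp (-((Finset.univ.sup' Finset.univ_nonempty fun k =>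
            2 * (L (c j k) x - q / 2)) ^ 2)) - w₀ := by
    refine le_trans ?_ (Finset.le_sup' _ (Finset.mem_univ j))
    have := hm (Finset.univ.sup' Finset.univ_nonempty fun k =>
            2 * (L (c j k) x - q / 2)) ?_ ?_
    · linarith
    · refine le_trans ?_ (Finset.le_sup' _ (Finset.mem_univ 0))
      linarith [(hLb 0).1]
    · apply Finset.sup'_le
      intro k _
      linarith [(hLb k).2]
  have key : ∀ d : ℝ, 0.7292 ≤ d → Real.exp (-(d ^ 2)) ≤ 0.6 := by
    intro d hd
    have h1 : Real.exp (-(d ^ 2)) ≤ Real.exp (-0.53) := by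
      apply Real.exp_le_exp.mpr
      nlinarith
    have h2 := Real.quadratic_le_exp_of_nonneg (x := 0.53) (by norm_num)
    have h3 : Real.exp (-0.53) * Real.exp 0.53 = 1 := by
      rw [← Real.exp_add]; norm_num
    have h4 := Real.exp_pos (-0.53)
    nlinarith
  exact absurd (key _ hd) (not_le.mpr hFx)
end
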